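/- arXiv:2305.01261 — 2 statements merged into one kernel-verified Lean document; each statement's English description precedes it below -/
import Mathlib

section
/- For a (v,b,r,λ,ε)-RPBD scheme (Q, \hat P_n) and any P ∈ Δ_v, the risk under the mean squared loss ℓ_2² equals R_{v,n}(ℓ_2², P, Q, \hat P_n) = (1/n)·[ ((re^ε + (v−1)(λe^ε + r − λ)) / ((r−λ)²(e^ε−1)²·v)) · ( v(b−r) + (v−1)(r−λ)(e^ε−1) ) + 1/v − Σ_{x=1}^v P_x² ]. -/
open Finset Real
open scoped Classical

noncomputable section

/-- The "row" of an incidence structure: outputs incident to input `x`. -/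
def Ix {v : ℕ} {Y : Type*} [Fintype Y] [DecidableEq Y]
    (I : Finset (Fin v × Y)) (x : Fin v) : Finset Y :=
  Finset.univ.filter (fun y => (x, y) ∈ I)

/-- The "column" of an incidence structure: inputs incident to output `y`. -/
def Iy {v : ℕ} {Y : Type*} [Fintype Y] [DecidableEq Y]
    (I : Finset (Fin v × Y)) (y : Y) : Finset (Fin v) :=
  Finset.univ.filter (fun x => (x, y) ∈ I)

/-- A `(v,b,r,lam)`-regular pairwise-balanced design (RPBD). -/
def IsRPBD {v : ℕ} {Y : Type*} [Fintype Y] [DecidableEq Y]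
    (I : Finset (Fin v × Y)) (b r lam : ℕ) : Prop :=
  0 < v ∧ Fintype.card Y = b ∧ lam < r ∧ r < b ∧
    (∀ x : Fin v, (Ix I x).card = r) ∧
    (∀ x x' : Fin v, x ≠ x' → (Ix I x ∩ Ix I x').card = lam)

/-- A `(v,b,r,k,lam)`-block design: an RPBD that is moreover `k`-uniform, with `0 < k < v`. -/
def IsBlockDesign {v : ℕ} {Y : Type*} [Fintype Y] [DecidableEq Y]
    (I : Finset (Fin v × Y)) (b r k lam : ℕ) : Prop :=
  IsRPBD I b r lam ∧ 0 < k ∧ k < v ∧ ∀ y : Y, (Iy I y).card = k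

/-- The (block design / RPBD) privacy mechanism: output `y` has probability `α e^ε` if
`(x,y) ∈ I` and `α` otherwise, where `α = 1/(r e^ε + b - r)`. -/
def mechQ {v : ℕ} {Y : Type*} [Fintype Y] [DecidableEq Y]
    (I : Finset (Fin v × Y)) (b r : ℕ) (ε : ℝ) (x : Fin v) (y : Y) : ℝ :=
  if (x, y) ∈ I then Real.exp ε / ((r : ℝ) * Real.exp ε + (b : ℝ) - (r : ℝ))
  else 1 / ((r : ℝ) * Real.exp ε + (b : ℝ) - (r : ℝ))

/-- The probability simplex `Δ_v` on `{1,…,v}`. -/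
def simplex (v : ℕ) : Set (Fin v → ℝ) :=
  {P | (∀ x, 0 ≤ P x) ∧ ∑ x, P x = 1}

/-- Marginal distribution of a single privatized output `Y` when `X ~ P`, `Y ~ Q(·|X)`. -/
def outDist {v : ℕ} {Y : Type*} [Fintype Y] (P : Fin v → ℝ) (Q : Fin v → Y → ℝ) (y : Y) : ℝ :=
  ∑ x, P x * Q x y

/-- Joint probability of the i.i.d. outputs `(Y_1,…,Y_n)`. -/
def jointW {v n : ℕ} {Y : Type*} [Fintype Y] (P : Fin v → ℝ) (Q : Fin v → Y → ℝ)
    (ys : Fin n → Y) : ℝ :=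
  ∏ i, outDist P Q (ys i)

/-- The count `N_x(Y_1,…,Y_n) = Σ_i 1(Y_i ∈ ℐ_x)`. -/
def Nx {v n : ℕ} {Y : Type*} [Fintype Y] [DecidableEq Y]
    (I : Finset (Fin v × Y)) (x : Fin v) (ys : Fin n → Y) : ℕ :=
  (Finset.univ.filter (fun i => ys i ∈ Ix I x)).card

/-- The canonical (unbiased) estimator of an RPBD scheme. -/
def canonEst {v n : ℕ} {Y : Type*} [Fintype Y] [DecidableEq Y]
    (I : Finset (Fin v × Y)) (b r lam : ℕ) (ε : ℝ) (x : Fin v) (ys : Fin n → Y) : ℝ :=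
  (1 / (((r : ℝ) - (lam : ℝ)) * (Real.exp ε - 1))) *
    ((Nx I x ys : ℝ) * ((r : ℝ) * Real.exp ε + (b : ℝ) - (r : ℝ)) / (n : ℝ)
      - ((lam : ℝ) * Real.exp ε + ((r : ℝ) - (lam : ℝ))))

/-- The squared `ℓ_2` loss. -/
def l2loss (v : ℕ) (p phat : Fin v → ℝ) : ℝ := ∑ x, (p x - phat x) ^ 2

/-- The risk `R_{v,n}(ℓ, P, Q, P̂_n) = E[ℓ(P, P̂_n(Y_1,…,Y_n))]`. -/
def risk {v : ℕ} {Y : Type*} [Fintype Y] (n : ℕ) (P : Fin v → ℝ) (Q : Fin v → Y → ℝ)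
    (L : (Fin v → ℝ) → (Fin v → ℝ) → ℝ) (est : Fin v → (Fin n → Y) → ℝ) : ℝ :=
  ∑ ys : Fin n → Y, jointW P Q ys * L P (fun x => est x ys)

/-- Marginal equivalence of two schemes: for every `P ∈ Δ_v` and coordinate `x`, the
estimators `P̂_{n,x}` and `P̂'_{n,x}` have the same distribution. -/
def MargEquiv {v : ℕ} {Y Y' : Type*} [Fintype Y] [Fintype Y'] (n : ℕ)
    (Q : Fin v → Y → ℝ) (est : Fin v → (Fin n → Y) → ℝ)
    (Q' : Fin v → Y' → ℝ) (est' : Fin v → (Fin n → Y') → ℝ) : Prop :=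
  ∀ P ∈ simplex v, ∀ x : Fin v, ∀ t : ℝ,
    (∑ ys : Fin n → Y, if est x ys = t then jointW P Q ys else 0)
      = ∑ ys : Fin n → Y', if est' x ys = t then jointW P Q' ys else 0

/-- First moment of a sum of i.i.d. centred variables on a finite type. -/
theorem sum_prod_mul_sum_eq_zero {Y : Type*} [Fintype Y] {w g : Y → ℝ}
    (hw : ∑ y, w y = 1) (hg : ∑ y, w y * g y = 0) (n : ℕ) :
    ∑ ys : Fin n → Y, (∏ i, w (ys i)) * ∑ i, g (ys i) = 0 := by
  have hprod (m : ℕ) : ∑ ys : Fin m → Y, ∏ i, w (ys i) = 1 := by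
    rw [← Fintype.sum_pow, hw, one_pow]
  induction n with
  | zero => simp
  | succ n ih =>
    rw [← (Fin.consEquiv fun _ : Fin (n + 1) => Y).sum_comp, Fintype.sum_prod_type]
    calc
      _ = ∑ y, ∑ ys : Fin n → Y, (w y * g y * ∏ i, w (ys i)
            + w y * ((∏ i, w (ys i)) * ∑ i, g (ys i))) := by
        refine sum_congr rfl fun y _ => sum_congr rfl fun ys _ => ?_
        simp only [Fin.consEquiv_apply, Fin.prod_univ_succ, Fin.sum_univ_succ, Fin.cons_zero,
          Fin.cons_succ]
        ring
      _ = 0 := by simp only [sum_add_distrib, ← mul_sum, hprod, ih, mul_one, mul_zero, hg, add_zero]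

/-- Variance of a sum of i.i.d. centred variables on a finite type. -/
theorem sum_prod_mul_sum_sq {Y : Type*} [Fintype Y] {w g : Y → ℝ}
    (hw : ∑ y, w y = 1) (hg : ∑ y, w y * g y = 0) (n : ℕ) :
    ∑ ys : Fin n → Y, (∏ i, w (ys i)) * (∑ i, g (ys i)) ^ 2 = n * ∑ y, w y * g y ^ 2 := by
  have hprod (m : ℕ) : ∑ ys : Fin m → Y, ∏ i, w (ys i) = 1 := by
    rw [← Fintype.sum_pow, hw, one_pow]
  induction n with
  | zero => simp
  | succ n ih =>
    rw [← (Fin.consEquiv fun _ : Fin (n + 1) => Y).sum_comp, Fintype.sum_prod_type]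
    calc
      _ = ∑ y, ∑ ys : Fin n → Y, (w y * g y ^ 2 * ∏ i, w (ys i)
            + 2 * (w y * g y) * ((∏ i, w (ys i)) * ∑ i, g (ys i))
            + w y * ((∏ i, w (ys i)) * (∑ i, g (ys i)) ^ 2)) := by
        refine sum_congr rfl fun y _ => sum_congr rfl fun ys _ => ?_
        simp only [Fin.consEquiv_apply, Fin.prod_univ_succ, Fin.sum_univ_succ, Fin.cons_zero,
          Fin.cons_succ]
        ring
      _ = _ := by
        simp only [sum_add_distrib, ← mul_sum, hprod, ih, mul_one,
          sum_prod_mul_sum_eq_zero hw hg, mul_zero, add_zero, ← sum_mul, hw]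
        push_cast
        ring

/-- The mean squared error of an empirical frequency. -/
theorem sum_prod_mul_freq_sub_sq {Y : Type*} [Fintype Y] [DecidableEq Y] {w : Y → ℝ}
    (hw : ∑ y, w y = 1) (S : Finset Y) {n : ℕ} (hn : 0 < n) :
    ∑ ys : Fin n → Y, (∏ i, w (ys i)) *
        (∑ y ∈ S, w y - (#{i | ys i ∈ S} : ℝ) / n) ^ 2
      = (∑ y ∈ S, w y) * (1 - ∑ y ∈ S, w y) / n := by
  have hn' : (n : ℝ) ≠ 0 := by positivity
  set q := ∑ y ∈ S, w y with hq
  set g : Y → ℝ := fun y => (if y ∈ S then 1 else 0) - q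
  have hS : ∑ y, w y * (if y ∈ S then (1 : ℝ) else 0) = q := by simp [hq]
  have hg : ∑ y, w y * g y = 0 := by
    simp only [g, mul_sub, sum_sub_distrib, hS, ← sum_mul, hw]
    ring
  have hg2 : ∑ y, w y * g y ^ 2 = q * (1 - q) := by
    calc
      _ = ∑ y, ((1 - 2 * q) * (w y * (if y ∈ S then (1 : ℝ) else 0)) + q ^ 2 * w y) := by
        refine sum_congr rfl fun y _ => ?_
        simp only [g]
        split_ifs <;> ring
      _ = _ := by
        rw [sum_add_distrib, ← mul_sum, ← mul_sum, hS, hw]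
        ring
  have hsum (ys : Fin n → Y) : ∑ i, g (ys i) = (#{i | ys i ∈ S} : ℝ) - n * q := by
    simp [g, sum_sub_distrib]
  calc
    _ = ∑ ys : Fin n → Y, (1 / (n : ℝ) ^ 2) * ((∏ i, w (ys i)) * (∑ i, g (ys i)) ^ 2) := by
      refine sum_congr rfl fun ys _ => ?_
      rw [hsum]
      field_simp
      ring
    _ = _ := by
      rw [← mul_sum, sum_prod_mul_sum_sq hw hg, hg2]
      field_simp

/-- The mass which the mechanism puts on a set of outputs, in terms of the incidences in it. -/
theorem sum_mechQ {v : ℕ} {Y : Type*} [Fintype Y] [DecidableEq Y]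
    (I : Finset (Fin v × Y)) (b r : ℕ) (ε : ℝ) (x : Fin v) (S : Finset Y) :
    ∑ y ∈ S, mechQ I b r ε x y
      = (#(Ix I x ∩ S) * (Real.exp ε - 1) + #S) / (r * Real.exp ε + b - r) := by
  have hmem (y : Y) : mechQ I b r ε x y
      = ((if y ∈ Ix I x then 1 else 0) * (Real.exp ε - 1) + 1) / (r * Real.exp ε + b - r) := by
    simp only [mechQ, Ix, mem_filter, mem_univ, true_and]
    split_ifs <;> ring
  simp only [hmem, ← sum_div, sum_add_distrib, ← sum_mul, sum_boole, sum_const, nsmul_eq_mul,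
    mul_one, filter_mem_eq_inter, inter_comm S]

theorem sum_outDist {v : ℕ} {Y : Type*} [Fintype Y] (P : Fin v → ℝ) (Q : Fin v → Y → ℝ)
    (S : Finset Y) : ∑ y ∈ S, outDist P Q y = ∑ x, P x * ∑ y ∈ S, Q x y := by
  simp only [outDist, mul_sum]
  exact sum_comm

/-- Exact `ℓ_2²` risk of a `(v,b,r,lam,ε)`-RPBD scheme. -/
theorem rpbd_l2_risk {v n b r lam : ℕ} (hn : 0 < n) {Y : Type*}
    [Fintype Y] [DecidableEq Y] (I : Finset (Fin v × Y))
    (h : IsRPBD I b r lam) (ε : ℝ) (hε : 0 < ε)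
    (P : Fin v → ℝ) (hP : P ∈ simplex v) :
    risk n P (mechQ I b r ε) (l2loss v) (canonEst I b r lam ε)
      = (1 / (n : ℝ)) *
          ((((r : ℝ) * Real.exp ε
              + ((v : ℝ) - 1) * ((lam : ℝ) * Real.exp ε + (r : ℝ) - (lam : ℝ)))
            / (((r : ℝ) - (lam : ℝ)) ^ 2 * (Real.exp ε - 1) ^ 2 * (v : ℝ)))
          * ((v : ℝ) * ((b : ℝ) - (r : ℝ))
              + ((v : ℝ) - 1) * ((r : ℝ) - (lam : ℝ)) * (Real.exp ε - 1))
          + 1 / (v : ℝ) - ∑ x, P x ^ 2) := by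
  obtain ⟨hv, hcard, hlr, hrb, hreg, hbal⟩ := h
  obtain ⟨-, hP1⟩ := hP
  have hn' : (n : ℝ) ≠ 0 := by positivity
  have hv' : (v : ℝ) ≠ 0 := by positivity
  have hlr' : (r : ℝ) - lam ≠ 0 := sub_ne_zero.2 (by exact_mod_cast hlr.ne')
  have he : Real.exp ε - 1 ≠ 0 := (sub_pos.2 (Real.one_lt_exp_iff.2 hε)).ne'
  have hd : (r : ℝ) * Real.exp ε + b - r ≠ 0 := by
    have h₁ : (r : ℝ) < b := by exact_mod_cast hrb
    have h₂ : 0 ≤ (r : ℝ) * Real.exp ε := by positivity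
    linarith
  set w := outDist P (mechQ I b r ε) with hw_def
  have hw : ∑ y, w y = 1 := by
    rw [hw_def, sum_outDist]
    simp only [sum_mechQ, inter_univ, hreg, card_univ, hcard, ← sum_mul, hP1]
    field_simp
    ring
  have hq (x : Fin v) : ∑ y ∈ Ix I x, w y
      = (lam * Real.exp ε + (r - lam) + P x * ((r - lam) * (Real.exp ε - 1)))
        / (r * Real.exp ε + b - r) := by
    have hcap (x' : Fin v) :
        (#(Ix I x' ∩ Ix I x) : ℝ) = lam + (if x' = x then (r - lam : ℝ) else 0) := by
      split_ifs with hx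
      · simp [hx, hreg]
      · simp [hbal x' x hx]
    rw [hw_def, sum_outDist]
    simp only [sum_mechQ, hcap, hreg]
    calc
      _ = ∑ x', (P x' * ((lam * (Real.exp ε - 1) + r) / (r * Real.exp ε + b - r))
            + if x' = x then P x' * ((r - lam) * (Real.exp ε - 1) / (r * Real.exp ε + b - r))
              else 0) := by
        refine sum_congr rfl fun x' _ => ?_
        split_ifs <;> ring
      _ = _ := by
        rw [sum_add_distrib, ← sum_mul, hP1, sum_ite_eq' univ x, if_pos (mem_univ x)]
        ring
  set A : ℝ := lam * Real.exp ε + (r - lam) with hA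
  set c : ℝ := (r - lam) * (Real.exp ε - 1) with hc
  set d : ℝ := r * Real.exp ε + b - r with hd_def
  have hc0 : c ≠ 0 := mul_ne_zero hlr' he
  have herr (x : Fin v) (ys : Fin n → Y) : (P x - canonEst I b r lam ε x ys) ^ 2
      = (d / c) ^ 2 * (∑ y ∈ Ix I x, w y - (#{i | ys i ∈ Ix I x} : ℝ) / n) ^ 2 := by
    rw [hq, canonEst, ← hA, ← hc, ← hd_def, Nx, ← mul_pow]
    congr 1
    field_simp
    ring
  have hmse (x : Fin v) :
      ∑ ys : Fin n → Y, (∏ i, w (ys i)) * (P x - canonEst I b r lam ε x ys) ^ 2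
        = (d / c) ^ 2 * (((A + P x * c) / d) * (1 - (A + P x * c) / d) / n) := by
    rw [← hq, ← sum_prod_mul_freq_sub_sq hw (Ix I x) hn, mul_sum]
    refine sum_congr rfl fun ys _ => ?_
    rw [herr, mul_left_comm]
  simp only [risk, l2loss, jointW, mul_sum]
  rw [sum_comm]
  simp only [← hw_def, hmse]
  calc
    _ = ∑ x, (1 / (n * c ^ 2) * (A * (d - A)) + 1 / (n * c) * (d - 2 * A) * P x
          - 1 / n * P x ^ 2) := by
      refine sum_congr rfl fun x _ => ?_
      field_simp
      ring
    _ = 1 / (n * c ^ 2) * (A * (d - A)) * v + 1 / (n * c) * (d - 2 * A)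
          - 1 / n * ∑ x, P x ^ 2 := by
      rw [sum_sub_distrib, sum_add_distrib, sum_const, card_univ, Fintype.card_fin, nsmul_eq_mul,
        ← mul_sum, ← mul_sum, hP1]
      ring
    _ = _ := by
      have hr : (r : ℝ) * Real.exp ε = A + c := by rw [hA, hc]; ring
      have hA' : (lam : ℝ) * Real.exp ε + r - lam = A := by rw [hA]; ring
      have hd' : d = A + c + (b - r) := by rw [hd_def, hr]; ring
      rw [hA', hr, mul_assoc ((v : ℝ) - 1), ← hc, ← mul_pow, ← hc, hd']
      field_simp
      ring

end
end

section
/- Let v ≥ 4 be an even integer, ε > 0, and k = v/2. Then k ∈ K_opt(v,ε) if and only if ε ≤ (1/2)·log( (v+2)/(v−2) ). -/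
open Finset Real

noncomputable section

/-- `L(v,k,ε) = (k e^ε + v - k)² / (k (v-k))`. -/
def Lfun (v k : ℕ) (ε : ℝ) : ℝ :=
  ((k : ℝ) * Real.exp ε + (v : ℝ) - (k : ℝ)) ^ 2 / ((k : ℝ) * ((v : ℝ) - (k : ℝ)))

/-- `K_opt(v,ε)`: the set of `k ∈ {1,…,v-1}` minimizing `L(v,k,ε)`. -/
def Kopt (v : ℕ) (ε : ℝ) : Set ℕ :=
  {k | k ∈ Finset.Icc 1 (v - 1) ∧ ∀ k' ∈ Finset.Icc 1 (v - 1), Lfun v k ε ≤ Lfun v k' ε}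

/-- `E(k₁,k₂;v) = √((v-k₁)(v-k₂)/(k₁k₂))`. -/
def Efun (k₁ k₂ v : ℕ) : ℝ :=
  Real.sqrt (((v : ℝ) - (k₁ : ℝ)) * ((v : ℝ) - (k₂ : ℝ)) / ((k₁ : ℝ) * (k₂ : ℝ)))

/-- Comparing the midpoint `m` of `{1, …, 2m - 1}` with `k` reduces to the sign of a product. -/
lemma Lfun_half_le_iff {m k : ℕ} (hk : 0 < k) (hkm : k < 2 * m) (ε : ℝ) :
    Lfun (2 * m) m ε ≤ Lfun (2 * m) k ε ↔
      0 ≤ ((k : ℝ) - m) * (Real.exp ε ^ 2 * k - (2 * m - k)) := by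
  have hm : (0 : ℝ) < m := by
    have : 0 < m := by omega
    exact_mod_cast this
  have hk0 : (0 : ℝ) < k := by exact_mod_cast hk
  have hkm0 : (0 : ℝ) < 2 * m - k := by
    have : (k : ℝ) < 2 * m := by exact_mod_cast hkm
    linarith
  have key : Lfun (2 * m) k ε - Lfun (2 * m) m ε =
      2 / (k * (2 * m - k)) * (((k : ℝ) - m) * (Real.exp ε ^ 2 * k - (2 * m - k))) := by
    have hmm : (2 * m - m : ℝ) = m := by ring
    unfold Lfun
    push_cast
    rw [hmm]
    field_simp
    ring
  rw [← sub_nonneg, key]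
  exact mul_nonneg_iff_of_pos_left (by positivity)

/-- The threshold `ε ≤ (1/2)·log((v+2)/(v-2))` at `v = 2m`, in polynomial form. -/
lemma le_half_log_iff {m : ℝ} (hm : 1 < m) (ε : ℝ) :
    ε ≤ (1 / 2) * Real.log ((2 * m + 2) / (2 * m - 2)) ↔
      Real.exp ε ^ 2 * (m - 1) ≤ m + 1 := by
  have hm1 : 0 < m - 1 := by linarith
  have hr : (2 * m + 2) / (2 * m - 2) = (m + 1) / (m - 1) := by
    rw [div_eq_div_iff (by linarith) hm1.ne']
    ring
  have hexp : Real.exp ε ^ 2 = Real.exp (2 * ε) := by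
    rw [← Real.exp_nat_mul]
    norm_num
  rw [hr, hexp, ← le_div_iff₀ hm1, ← Real.le_log_iff_exp_le (by positivity)]
  constructor <;> intro h <;> linarith

/-- For even `v ≥ 4` and `k = v/2`:
`k ∈ K_opt(v,ε)` iff `ε ≤ (1/2)·log((v+2)/(v−2))`. -/
theorem Kopt_even_half (v : ℕ) (hv : 4 ≤ v) (heven : Even v) (ε : ℝ) (hε : 0 < ε) :
    v / 2 ∈ Kopt v ε ↔
      ε ≤ (1 / 2) * Real.log (((v : ℝ) + 2) / ((v : ℝ) - 2)) := by
  obtain ⟨m, rfl⟩ := heven.two_dvd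
  have hm : 2 ≤ m := by omega
  have hm2 : (2 : ℝ) ≤ m := by exact_mod_cast hm
  have hx : 1 < Real.exp ε := Real.one_lt_exp_iff.mpr hε
  have hx2 : 1 < Real.exp ε ^ 2 := one_lt_pow₀ hx two_ne_zero
  rw [Nat.mul_div_cancel_left m two_pos]
  push_cast
  rw [le_half_log_iff (by linarith)]
  constructor
  · rintro ⟨-, h⟩
    have h1 := (Lfun_half_le_iff (by omega) (by omega) ε).mp
      (h (m - 1) (Finset.mem_Icc.mpr ⟨by omega, by omega⟩))
    rw [Nat.cast_sub (by omega)] at h1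
    push_cast at h1
    linarith
  · refine fun h => ⟨Finset.mem_Icc.mpr ⟨by omega, by omega⟩, fun k hk => ?_⟩
    obtain ⟨hk1, hk2⟩ := Finset.mem_Icc.mp hk
    rw [Lfun_half_le_iff (by omega) (by omega)]
    have hk0 : (0 : ℝ) ≤ k := k.cast_nonneg
    rcases le_or_gt m k with hmk | hmk
    · have hmk' : (m : ℝ) ≤ k := by exact_mod_cast hmk
      exact mul_nonneg (by linarith) (by nlinarith)
    · have hmk' : (k : ℝ) + 1 ≤ m := by exact_mod_cast hmk
      exact mul_nonneg_of_nonpos_of_nonpos (by linarith) (by nlinarith)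

end
end
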